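/- Let n ≥ 1 and let W : ℝ^n → ℝ be a bounded continuous function such that W(x) > W(0) for every x ≠ 0 and W(x) → L as ‖x‖ → ∞ (convergence along the cocompact filter) for some real L with W(0) < L. Let (μ_m)_{m∈ℕ} be a sequence of Borel probability measures on ℝ^n with ∫ W dμ_m → W(0) as m → ∞. Then: (i) for every ε > 0, μ_m({x : ‖x‖ > ε}) → 0 as m → ∞; and (ii) for every bounded continuous f : ℝ^n → ℝ, ∫ f dμ_m → f(0) as m → ∞. -/

import Mathlib

open MeasureTheory Filter

section Concentration

variable {E : Type*} [NormedAddCommGroup E]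

/-- A continuous function with a strict global minimum at `0` and a larger limit at infinity
is bounded away from its minimum outside every ball around `0`. -/
theorem exists_gap_of_strict_min {W : E → ℝ} (hWc : Continuous W)
    (hWmin : ∀ x : E, x ≠ 0 → W 0 < W x) {L : ℝ} (hWL : Tendsto W (cocompact E) (nhds L))
    (hL : W 0 < L) {ε : ℝ} (hε : 0 < ε) :
    ∃ c > 0, ∀ x : E, ε ≤ ‖x‖ → c ≤ W x - W 0 := by
  obtain ⟨b, hb0, hbL⟩ := exists_between hL
  obtain ⟨t, ht, htW⟩ := mem_cocompact.1 (hWL.eventually (lt_mem_nhds hbL))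
  have hK : IsCompact (t ∩ {x : E | ε ≤ ‖x‖}) :=
    ht.inter_right (isClosed_le continuous_const continuous_norm)
  obtain ⟨a, ha0, ha⟩ := hK.exists_forall_le' hWc.continuousOn (a := W 0) fun x hx =>
    hWmin x (norm_pos_iff.1 (hε.trans_le hx.2))
  refine ⟨min a b - W 0, sub_pos.2 (lt_min ha0 hb0), fun x hx => sub_le_sub_right ?_ _⟩
  by_cases hxt : x ∈ t
  · exact (min_le_left _ _).trans (ha x ⟨hxt, hx⟩)
  · exact (min_le_right _ _).trans (le_of_lt (htW hxt))

variable [MeasurableSpace E]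

/-- Markov's inequality for the excess of `W` over `W 0`. -/
theorem mul_measureReal_norm_gt_le {W : E → ℝ} (hW0 : ∀ x, W 0 ≤ W x) {ε c : ℝ}
    (hc : 0 ≤ c) (hgap : ∀ x : E, ε ≤ ‖x‖ → c ≤ W x - W 0)
    (ν : Measure E) [IsProbabilityMeasure ν] (hW : Integrable W ν) :
    c * ν.real {x : E | ε < ‖x‖} ≤ ∫ x, W x ∂ν - W 0 := by
  have hmarkov := mul_meas_ge_le_integral_of_nonneg (μ := ν) (f := fun x => W x - W 0)
    (Eventually.of_forall fun x => sub_nonneg.2 (hW0 x)) (hW.sub (integrable_const _)) c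
  rw [integral_sub hW (integrable_const _)] at hmarkov
  simp only [integral_const, probReal_univ, one_smul] at hmarkov
  refine (mul_le_mul_of_nonneg_left (measureReal_mono ?_) hc).trans hmarkov
  exact fun x hx => hgap x (le_of_lt hx)

/-- If the excess of `W` over `W 0` controls `|f - f 0|` up to a constant, then it controls
the deviation of the average of `f` from `f 0`. -/
theorem abs_integral_sub_le_of_abs_sub_le {W f : E → ℝ} {η K : ℝ}
    (hfW : ∀ x, |f x - f 0| ≤ η + K * (W x - W 0))
    (ν : Measure E) [IsProbabilityMeasure ν] (hW : Integrable W ν) (hf : Integrable f ν) :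
    |∫ x, f x ∂ν - f 0| ≤ η + K * (∫ x, W x ∂ν - W 0) := by
  have hWs : Integrable (fun x => K * (W x - W 0)) ν :=
    (hW.sub (integrable_const _)).const_mul K
  calc |∫ x, f x ∂ν - f 0| = |∫ x, (f x - f 0) ∂ν| := by
        rw [integral_sub hf (integrable_const _)]; simp
    _ ≤ ∫ x, |f x - f 0| ∂ν := abs_integral_le_integral_abs
    _ ≤ ∫ x, (η + K * (W x - W 0)) ∂ν :=
        integral_mono (hf.sub (integrable_const _)).abs ((integrable_const _).add hWs) hfW
    _ = η + K * (∫ x, W x ∂ν - W 0) := by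
        rw [integral_add (integrable_const _) hWs, integral_const_mul,
          integral_sub hW (integrable_const _)]
        simp

end Concentration


/-- Abstract content of the concentration lemma (Lemma 3.10 of the paper): if
`W` is bounded continuous with unique strict global minimum at `0`, tends to
`L > W 0` at infinity, and probability measures `μ m` satisfy
`∫ W dμ m → W 0`, then the `μ m` concentrate at the origin: the mass outside
any ball around `0` tends to `0`, and `∫ f dμ m → f 0` for every bounded
continuous `f`. -/
theorem stmt10 (n : ℕ) (hn : 1 ≤ n)
    (W : EuclideanSpace ℝ (Fin n) → ℝ) (hWc : Continuous W)
    (M : ℝ) (hWb : ∀ x, |W x| ≤ M)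
    (hWmin : ∀ x : EuclideanSpace ℝ (Fin n), x ≠ 0 → W 0 < W x)
    (L : ℝ) (hWL : Tendsto W (cocompact (EuclideanSpace ℝ (Fin n))) (nhds L))
    (hL : W 0 < L)
    (μ : ℕ → Measure (EuclideanSpace ℝ (Fin n)))
    (hprob : ∀ m, IsProbabilityMeasure (μ m))
    (hconv : Tendsto (fun m => ∫ x, W x ∂(μ m)) atTop (nhds (W 0))) :
    (∀ ε > (0 : ℝ),
      Tendsto (fun m => μ m {x : EuclideanSpace ℝ (Fin n) | ε < ‖x‖}) atTop (nhds 0)) ∧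
    (∀ f : EuclideanSpace ℝ (Fin n) → ℝ, Continuous f → (∃ Mf, ∀ x, |f x| ≤ Mf) →
      Tendsto (fun m => ∫ x, f x ∂(μ m)) atTop (nhds (f 0))) := by
  have hW0 : ∀ x, W 0 ≤ W x := fun x => by
    rcases eq_or_ne x 0 with rfl | hx
    · exact le_rfl
    · exact (hWmin x hx).le
  have hWint : ∀ m, Integrable W (μ m) := fun m =>
    Integrable.of_bound hWc.aestronglyMeasurable M (Eventually.of_forall hWb)
  have hexc : Tendsto (fun m => ∫ x, W x ∂(μ m) - W 0) atTop (nhds 0) := by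
    simpa using hconv.sub_const (W 0)
  constructor
  · intro ε hε
    obtain ⟨c, hc, hgap⟩ := exists_gap_of_strict_min hWc hWmin hWL hL hε
    have hreal : Tendsto (fun m => (μ m).real {x : EuclideanSpace ℝ (Fin n) | ε < ‖x‖})
        atTop (nhds 0) := by
      refine squeeze_zero (fun m => measureReal_nonneg) (fun m => ?_)
        (by simpa using hexc.div_const c)
      rw [le_div_iff₀' hc]
      exact mul_measureReal_norm_gt_le hW0 hc.le hgap (μ m) (hWint m)
    simpa using ENNReal.tendsto_ofReal hreal
  · rintro f hfc ⟨Mf, hfb⟩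
    rw [Metric.tendsto_atTop']
    intro η hη
    obtain ⟨δ, hδ, hfδ⟩ := Metric.continuousAt_iff.1 hfc.continuousAt (η / 2) (half_pos hη)
    obtain ⟨c, hc, hgap⟩ := exists_gap_of_strict_min hWc hWmin hWL hL hδ
    have hMf : 0 ≤ Mf := (abs_nonneg _).trans (hfb 0)
    have hK : 0 ≤ 2 * Mf / c := by positivity
    have hfW : ∀ x, |f x - f 0| ≤ η / 2 + 2 * Mf / c * (W x - W 0) := fun x => by
      rcases lt_or_ge ‖x‖ δ with hx | hx
      · have hnear : |f x - f 0| < η / 2 := hfδ (by simpa using hx)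
        have := mul_nonneg hK (sub_nonneg.2 (hW0 x))
        linarith
      · have hfar := mul_le_mul_of_nonneg_left (hgap x hx) hK
        rw [div_mul_cancel₀ _ hc.ne'] at hfar
        have := abs_sub (f x) (f 0)
        linarith [hfb x, hfb 0]
    have hlim : Tendsto (fun m => η / 2 + 2 * Mf / c * (∫ x, W x ∂(μ m) - W 0)) atTop
        (nhds (η / 2)) := by
      simpa using (hexc.const_mul (2 * Mf / c)).const_add (η / 2)
    obtain ⟨N, hN⟩ := eventually_atTop.1 (hlim.eventually (gt_mem_nhds (half_lt_self hη)))
    refine ⟨N, fun m hm => ?_⟩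
    have hfint : Integrable f (μ m) :=
      Integrable.of_bound hfc.aestronglyMeasurable Mf (Eventually.of_forall hfb)
    exact (abs_integral_sub_le_of_abs_sub_le hfW (μ m) (hWint m) hfint).trans_lt (hN m hm.le)
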